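/- Let g be a nonsingular quadratic form with rational coefficients of signature (k,1) with 1 ≤ k ≤ 5. Then the quadratic form q_8 = -x_0^2 + x_1^2 + ... + x_8^2 represents g. -/

import Mathlib

namespace Paper

open Matrix

/-- Value at `x` of the quadratic form with Gram matrix `Q`. -/
def qeval {m : ℕ} {R : Type*} [CommRing R] (Q : Matrix (Fin m) (Fin m) R) (x : Fin m → R) : R :=
  x ⬝ᵥ (Q *ᵥ x)

/-- The polar bilinear form `B(x,y) = (f(x+y) - f(x) - f(y))/2` of the quadratic form
with Gram matrix `Q`. -/
def qpolar {m : ℕ} {K : Type*} [Field K] (Q : Matrix (Fin m) (Fin m) K) (x y : Fin m → K) : K :=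
  (qeval Q (x + y) - qeval Q x - qeval Q y) / 2

/-- A real quadratic form (given by its Gram matrix `Q`) has signature `(r,s)`:
`r + s = m` and it is linearly equivalent over `ℝ` to
`x_1^2 + ... + x_r^2 - x_{r+1}^2 - ... - x_m^2`. -/
def RealSignature {m : ℕ} (Q : Matrix (Fin m) (Fin m) ℝ) (r s : ℕ) : Prop :=
  r + s = m ∧ ∃ T : Matrix (Fin m) (Fin m) ℝ, T.det ≠ 0 ∧
    ∀ x : Fin m → ℝ, qeval Q (T *ᵥ x) = ∑ i : Fin m, (if (i : ℕ) < r then (x i)^2 else -(x i)^2)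

/-- A rational quadratic form has signature `(r,s)` if it does as a real quadratic form. -/
def HasSignature {m : ℕ} (Q : Matrix (Fin m) (Fin m) ℚ) (r s : ℕ) : Prop :=
  RealSignature (Q.map (Rat.cast : ℚ → ℝ)) r s

/-- The rational quadratic form `F` (in `n` variables) represents the rational quadratic
form `G` (in `k` variables): after a linear change of coordinates over `ℚ`,
`F(x_1,...,x_n) = G(x_1,...,x_k) + H(x_{k+1},...,x_n)` for some rational quadratic form `H`. -/
def Represents {n k : ℕ} (F : Matrix (Fin n) (Fin n) ℚ) (G : Matrix (Fin k) (Fin k) ℚ) : Prop :=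
  ∃ (m : ℕ) (hm : n = k + m) (H : Matrix (Fin m) (Fin m) ℚ) (T : Matrix (Fin n) (Fin n) ℚ),
    T.det ≠ 0 ∧ ∀ (x : Fin k → ℚ) (y : Fin m → ℚ),
      qeval F (T *ᵥ (Fin.append x y ∘ Fin.cast hm)) = qeval G x + qeval H y

/-- The group `O(f, A)` of matrices in `GL(m, A)` preserving the quadratic form `f`
(with Gram matrix `Q` over `K ⊇ A`): those `M` with `f(Mx) = f(x)` for all `x`. -/
def ortho {m : ℕ} (A : Type*) [CommRing A] {K : Type*} [Field K] [Algebra A K]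
    (Q : Matrix (Fin m) (Fin m) K) : Subgroup (GL (Fin m) A) where
  carrier := { M | ∀ x : Fin m → K,
      qeval Q (((M : Matrix (Fin m) (Fin m) A).map (algebraMap A K)) *ᵥ x) = qeval Q x }
  one_mem' := by
    intro x
    have h1 : ((1 : GL (Fin m) A) : Matrix (Fin m) (Fin m) A).map (algebraMap A K) = 1 := by
      simp [Matrix.map_one]
    rw [h1, Matrix.one_mulVec]
  mul_mem' := by
    intro a b ha hb x
    have h : ((a * b : GL (Fin m) A) : Matrix (Fin m) (Fin m) A).map (algebraMap A K)
        = ((a : Matrix (Fin m) (Fin m) A).map (algebraMap A K)) *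
          ((b : Matrix (Fin m) (Fin m) A).map (algebraMap A K)) := by
      rw [Units.val_mul, Matrix.map_mul]
    rw [h, ← Matrix.mulVec_mulVec, ha, hb]
  inv_mem' := by
    intro a ha x
    set M := ((a : Matrix (Fin m) (Fin m) A).map (algebraMap A K)) with hM
    set N := (((a⁻¹ : GL (Fin m) A) : Matrix (Fin m) (Fin m) A).map (algebraMap A K)) with hN
    have hMN : M * N = 1 := by
      rw [hM, hN, ← Matrix.map_mul]
      have : (a : Matrix (Fin m) (Fin m) A) * ((a⁻¹ : GL (Fin m) A) : Matrix (Fin m) (Fin m) A)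
          = 1 := a.mul_inv
      rw [this]
      simp [Matrix.map_one]
    have ha' : ∀ y : Fin m → K, qeval Q (M *ᵥ y) = qeval Q y := ha
    calc qeval Q (N *ᵥ x) = qeval Q (M *ᵥ (N *ᵥ x)) := (ha' (N *ᵥ x)).symm
      _ = qeval Q ((M * N) *ᵥ x) := by rw [Matrix.mulVec_mulVec]
      _ = qeval Q x := by rw [hMN, Matrix.one_mulVec]

/-- `O(f, ℤ)` for a rational quadratic form `f` with Gram matrix `Q`. -/
abbrev OZ {m : ℕ} (Q : Matrix (Fin m) (Fin m) ℚ) : Subgroup (GL (Fin m) ℤ) := ortho ℤ Q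

/-- A group is finitely presented: it is a quotient of a finitely generated free group by
the normal closure of a finite set of relators. -/
def IsFinitelyPresented (G : Type*) [Group G] : Prop :=
  ∃ (n : ℕ) (rels : Set (FreeGroup (Fin n))), rels.Finite ∧ Nonempty (PresentedGroup rels ≃* G)

/-- A group is coherent if each of its finitely generated subgroups is finitely presented. -/
def IsCoherent (G : Type*) [Group G] : Prop :=
  ∀ H : Subgroup G, Group.FG H → IsFinitelyPresented H

/-- Two groups are abstractly commensurable if they contain isomorphic
subgroups of finite index. -/
def AbstractlyCommensurable (G H : Type*) [Group G] [Group H] : Prop :=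
  ∃ (G' : Subgroup G) (H' : Subgroup H), G'.FiniteIndex ∧ H'.FiniteIndex ∧ Nonempty (G' ≃* H')

/-- The form `q₃ = -x₀² + x₁² + x₂² + x₃²`. -/
def q3 : Matrix (Fin 4) (Fin 4) ℚ := Matrix.diagonal ![-1, 1, 1, 1]

/-- The form `q₈ = -x₀² + x₁² + ... + x₈²`. -/
def q8 : Matrix (Fin 9) (Fin 9) ℚ :=
  Matrix.diagonal (fun i => if i = 0 then -1 else 1)

def vv (p : ℕ) (a : ℤ) : ℕ := padicValInt p a
def uu (p : ℕ) (a : ℤ) : ℤ := a / (p : ℤ) ^ vv p a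
def sg (x y : ℤ) : ℤ := if x = -1 ∧ y = -1 then -1 else 1
def hs (p : ℕ) (a b : ℤ) : ℤ :=
  if p = 2 then
    ZMod.χ₈ (uu 2 a : ℤ) ^ vv 2 b * ZMod.χ₈ (uu 2 b : ℤ) ^ vv 2 a *
      sg (ZMod.χ₄ (uu 2 a : ℤ)) (ZMod.χ₄ (uu 2 b : ℤ))
  else jacobiSym (-1) p ^ (vv p a * vv p b) * jacobiSym (uu p a) p ^ vv p b *
    jacobiSym (uu p b) p ^ vv p a

lemma vu_unique {p : ℕ} (hp : p.Prime) {a w : ℤ} {k : ℕ} (h : a = (p : ℤ) ^ k * w)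
    (hw : ¬ (p : ℤ) ∣ w) : vv p a = k ∧ uu p a = w := by
  have := Fact.mk hp
  have hw0 : w ≠ 0 := by rintro rfl; simp at hw
  have hp0 : (p : ℤ) ≠ 0 := by exact_mod_cast hp.ne_zero
  have h1 : vv p a = k := by
    unfold vv
    rw [h, padicValInt.mul (pow_ne_zero _ hp0) hw0, padicValInt.eq_zero_of_not_dvd hw]
    simp [padicValInt, Int.natAbs_pow]
  refine ⟨h1, ?_⟩
  unfold uu
  rw [h1, h, Int.mul_ediv_cancel_left _ (pow_ne_zero _ hp0)]

lemma vu_spec {p : ℕ} (hp : p.Prime) {a : ℤ} (ha : a ≠ 0) :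
    a = (p : ℤ) ^ vv p a * uu p a ∧ ¬ (p : ℤ) ∣ uu p a := by
  have hfin : FiniteMultiplicity (p : ℤ) a := by
    rw [Int.finiteMultiplicity_iff]; refine ⟨?_, ha⟩; simpa using hp.ne_one
  obtain ⟨c, hc, hd⟩ := hfin.exists_eq_pow_mul_and_not_dvd
  obtain ⟨h1, h2⟩ := vu_unique hp hc hd
  rw [h1, h2]; exact ⟨hc, hd⟩

lemma vu_mul {p : ℕ} (hp : p.Prime) {a b : ℤ} (ha : a ≠ 0) (hb : b ≠ 0) :
    vv p (a * b) = vv p a + vv p b ∧ uu p (a * b) = uu p a * uu p b := by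
  obtain ⟨h1, h2⟩ := vu_spec hp ha
  obtain ⟨h3, h4⟩ := vu_spec hp hb
  apply vu_unique hp
  · conv_lhs => rw [h1, h3]
    ring
  · intro h
    rcases (Nat.prime_iff_prime_int.mp hp).dvd_or_dvd h with h | h <;> contradiction

lemma vu_unit {p : ℕ} (hp : p.Prime) {a : ℤ} (ha : ¬ (p : ℤ) ∣ a) : vv p a = 0 ∧ uu p a = a :=
  vu_unique hp (by simp) ha

lemma jac_unit {p : ℕ} (hp : p.Prime) {a : ℤ} (ha : ¬ (p : ℤ) ∣ a) :
    jacobiSym a p = 1 ∨ jacobiSym a p = -1 := by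
  apply jacobiSym.eq_one_or_neg_one
  rw [Int.gcd_comm]
  exact (Nat.Coprime.symm (by
    rw [Nat.coprime_comm]
    exact (Nat.Prime.coprime_iff_not_dvd hp).2 (by simpa [Int.natCast_dvd] using ha)))

lemma two_unit_cases {a : ℤ} (ha : ¬ (2 : ℤ) ∣ a) :
    a % 8 = 1 ∨ a % 8 = 3 ∨ a % 8 = 5 ∨ a % 8 = 7 := by omega

lemma cast8 (a : ℤ) : ((a : ℤ) : ZMod 8) = ((a % 8 : ℤ) : ZMod 8) := by
  rw [ZMod.intCast_eq_intCast_iff]; exact (Int.mod_modEq a 8).symm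
lemma cast4 (a : ℤ) : ((a : ℤ) : ZMod 4) = ((a % 8 : ℤ) : ZMod 4) := by
  rw [ZMod.intCast_eq_intCast_iff]
  show a % 4 = (a % 8) % 4
  omega

lemma chi8_unit {a : ℤ} (ha : ¬ (2 : ℤ) ∣ a) : ZMod.χ₈ a = 1 ∨ ZMod.χ₈ a = -1 := by
  rw [cast8]
  rcases two_unit_cases ha with h | h | h | h <;> rw [h] <;> decide
lemma chi4_unit {a : ℤ} (ha : ¬ (2 : ℤ) ∣ a) : ZMod.χ₄ a = 1 ∨ ZMod.χ₄ a = -1 := by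
  rw [cast4]
  rcases two_unit_cases ha with h | h | h | h <;> rw [h] <;> decide

lemma hs_symm (p : ℕ) (a b : ℤ) : hs p a b = hs p b a := by
  unfold hs
  split_ifs
  · have : ∀ x y, sg x y = sg y x := by intro x y; unfold sg; simp only [and_comm]
    rw [this]; ring
  · ring

lemma sg_mul {x y z : ℤ} (hx : x = 1 ∨ x = -1) (hy : y = 1 ∨ y = -1) (hz : z = 1 ∨ z = -1) :
    sg (x * y) z = sg x z * sg y z := by
  rcases hx with rfl | rfl <;> rcases hy with rfl | rfl <;> rcases hz with rfl | rfl <;> decide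

lemma hs_mul_left {p : ℕ} (hp : p.Prime) {a a' b : ℤ} (ha : a ≠ 0) (ha' : a' ≠ 0) (hb : b ≠ 0) :
    hs p (a * a') b = hs p a b * hs p a' b := by
  obtain ⟨h1, h2⟩ := vu_mul hp ha ha'
  unfold hs
  split_ifs with h
  · subst h
    rw [h1, h2]
    have e8 : ZMod.χ₈ ((uu 2 a * uu 2 a' : ℤ) : ZMod 8) = ZMod.χ₈ (uu 2 a : ℤ) * ZMod.χ₈ (uu 2 a' : ℤ) := by
      rw [Int.cast_mul, map_mul]
    have e4 : ZMod.χ₄ ((uu 2 a * uu 2 a' : ℤ) : ZMod 4) = ZMod.χ₄ (uu 2 a : ℤ) * ZMod.χ₄ (uu 2 a' : ℤ) := by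
      rw [Int.cast_mul, map_mul]
    rw [e8, e4, sg_mul (chi4_unit (vu_spec hp ha).2) (chi4_unit (vu_spec hp ha').2)
      (chi4_unit (vu_spec hp hb).2)]
    ring
  · rw [h1, h2, jacobiSym.mul_left]; ring

lemma hs_mul_right {p : ℕ} (hp : p.Prime) {a b b' : ℤ} (ha : a ≠ 0) (hb : b ≠ 0) (hb' : b' ≠ 0) :
    hs p a (b * b') = hs p a b * hs p a b' := by
  rw [hs_symm, hs_mul_left hp hb hb' ha, hs_symm p b, hs_symm p b']

lemma hs_val {p : ℕ} (hp : p.Prime) {a b : ℤ} (ha : a ≠ 0) (hb : b ≠ 0) :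
    hs p a b = 1 ∨ hs p a b = -1 := by
  have pw : ∀ {x : ℤ}, (x = 1 ∨ x = -1) → ∀ n : ℕ, x ^ n = 1 ∨ x ^ n = -1 := by
    intro x hx n
    rcases hx with rfl | rfl
    · simp
    · exact neg_one_pow_eq_or ℤ n
  have ml : ∀ {x y : ℤ}, (x = 1 ∨ x = -1) → (y = 1 ∨ y = -1) → (x * y = 1 ∨ x * y = -1) := by
    intro x y hx hy
    rcases hx with rfl | rfl <;> rcases hy with rfl | rfl <;> decide
  unfold hs
  split_ifs with h
  · subst h
    refine ml (ml (pw (chi8_unit (vu_spec hp ha).2) _) (pw (chi8_unit (vu_spec hp hb).2) _)) ?_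
    unfold sg; split_ifs <;> simp
  · refine ml (ml (pw (jac_unit hp ?_) _) (pw (jac_unit hp (vu_spec hp ha).2) _))
      (pw (jac_unit hp (vu_spec hp hb).2) _)
    rw [Int.dvd_neg, ← Nat.cast_one, Int.natCast_dvd_natCast, Nat.dvd_one]
    exact hp.ne_one

lemma hs_sq {p : ℕ} (hp : p.Prime) {a b : ℤ} (ha : a ≠ 0) (hb : b ≠ 0) : hs p (a * a) b = 1 := by
  rw [hs_mul_left hp ha ha hb]
  rcases hs_val hp ha hb with h | h <;> rw [h] <;> rfl

lemma hs_one {p : ℕ} (hp : p.Prime) {b : ℤ} (hb : b ≠ 0) : hs p 1 b = 1 := by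
  simpa using hs_sq hp one_ne_zero hb

lemma hs_unit {p : ℕ} (hp : p.Prime) (h2 : p ≠ 2) {a b : ℤ} (ha : ¬ (p : ℤ) ∣ a)
    (hb : ¬ (p : ℤ) ∣ b) : hs p a b = 1 := by
  unfold hs
  rw [if_neg h2, (vu_unit hp ha).1, (vu_unit hp hb).1]; simp

lemma prime_not_dvd {p q : ℕ} (hp : p.Prime) (hq : q.Prime) (h : p ≠ q) : ¬ (p : ℤ) ∣ (q : ℤ) := by
  rw [Int.natCast_dvd_natCast, Nat.prime_dvd_prime_iff_eq hp hq]; exact h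

lemma vu_self {p : ℕ} (hp : p.Prime) : vv p p = 1 ∧ uu p p = 1 :=
  vu_unique hp (by simp) (by
    rw [← Nat.cast_one, Int.natCast_dvd_natCast, Nat.dvd_one]; exact hp.ne_one)

lemma chi4_cases {p : ℕ} (hp : p.Prime) (h2 : p ≠ 2) :
    (p % 4 = 1 ∧ ZMod.χ₄ p = 1) ∨ (p % 4 = 3 ∧ ZMod.χ₄ p = -1) := by
  have := hp.eq_two_or_odd.resolve_left h2
  have h4 : p % 4 = 1 ∨ p % 4 = 3 := by omega
  rcases h4 with h | h
  · exact Or.inl ⟨h, ZMod.χ₄_nat_one_mod_four h⟩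
  · exact Or.inr ⟨h, ZMod.χ₄_nat_three_mod_four h⟩

lemma hs22 : hs 2 ((2 : ℕ) : ℤ) ((2 : ℕ) : ℤ) = 1 := by
  obtain ⟨h1, h2⟩ := vu_self Nat.prime_two
  unfold hs
  rw [if_pos rfl, h1, h2]; simp; decide

lemma hs_self_right {p q : ℕ} (hp : p.Prime) (hq : q.Prime) (h : p ≠ q) (h2 : q ≠ 2) :
    hs q p q = jacobiSym p q := by
  obtain ⟨h3, h4⟩ := vu_self hq
  obtain ⟨h5, h6⟩ := vu_unit hq (prime_not_dvd hq hp h.symm)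
  unfold hs
  rw [if_neg h2, h3, h4, h5, h6]; simp

lemma prod_prime {p q : ℕ} (hp : p.Prime) (hq : q.Prime) (S : Finset ℕ) (hS : ∀ l ∈ S, l.Prime)
    (h2 : 2 ∈ S) (hpS : p ∈ S) (hqS : q ∈ S) : ∏ l ∈ S, hs l p q = 1 := by
  have key : ∏ l ∈ ({2, p, q} : Finset ℕ), hs l p q = ∏ l ∈ S, hs l p q := by
    apply Finset.prod_subset
    · intro x hx; simp at hx; rcases hx with rfl | rfl | rfl <;> assumption
    · intro x hx hx2
      simp at hx2
      exact hs_unit (hS x hx) hx2.1 (prime_not_dvd (hS x hx) hp hx2.2.1)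
        (prime_not_dvd (hS x hx) hq hx2.2.2)
  rw [← key]
  clear key
  have main2 : ∀ q : ℕ, q.Prime → q ≠ 2 →
      hs 2 (2 : ℕ) q * hs q (2 : ℕ) q = 1 := by
    intro q hq hq2
    rw [hs_self_right Nat.prime_two hq hq2.symm hq2]
    obtain ⟨h1, h2⟩ := vu_self Nat.prime_two
    obtain ⟨h5, h6⟩ := vu_unit Nat.prime_two (prime_not_dvd Nat.prime_two hq hq2.symm)
    have hodd : Odd q := hq.odd_of_ne_two hq2
    unfold hs
    rw [if_pos rfl, h1, h2, h5, h6]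
    have := chi8_unit (a := q) (prime_not_dvd Nat.prime_two hq hq2.symm)
    have e : jacobiSym ((2 : ℕ) : ℤ) q = ZMod.χ₈ q := jacobiSym.at_two hodd
    rw [e]
    simp [sg]
    simp at this
    rcases this with h | h <;> rw [h] <;> simp
  by_cases hp2 : p = 2
  · subst hp2
    by_cases hq2 : q = 2
    · subst hq2
      simpa using hs22
    · rw [Finset.insert_eq_of_mem (by simp), Finset.prod_pair (Ne.symm hq2)]
      exact main2 q hq hq2
  · by_cases hq2 : q = 2
    · subst hq2
      have : ({2, p, 2} : Finset ℕ) = {2, p} := by ext; simp; tauto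
      rw [this, Finset.prod_pair (Ne.symm hp2), hs_symm, hs_symm p]
      exact main2 p hp hp2
    · obtain ⟨h1, h2⟩ := vu_unit Nat.prime_two (prime_not_dvd Nat.prime_two hp (Ne.symm hp2))
      obtain ⟨h3, h4⟩ := vu_unit Nat.prime_two (prime_not_dvd Nat.prime_two hq (Ne.symm hq2))
      have e2 : hs 2 p q = sg (ZMod.χ₄ p) (ZMod.χ₄ q) := by
        unfold hs
        rw [if_pos rfl, h1, h2, h3, h4]; simp
      by_cases hpq : p = q
      · subst hpq
        have : ({2, p, p} : Finset ℕ) = {2, p} := by ext; simp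
        rw [this, Finset.prod_pair (Ne.symm hp2), e2]
        obtain ⟨h5, h6⟩ := vu_self hp
        have : hs p p p = ZMod.χ₄ p := by
          unfold hs
          rw [if_neg hp2, h5, h6, ← jacobiSym.at_neg_one (hp.odd_of_ne_two hp2)]; simp
        rw [this]
        rcases chi4_cases hp hp2 with h | h <;> rw [h.2] <;> decide
      · rw [Finset.prod_insert (by simp; tauto), Finset.prod_pair hpq, e2,
          hs_self_right hp hq hpq hq2, hs_symm, hs_self_right hq hp (Ne.symm hpq) hp2]
        have jj := jac_unit hp (prime_not_dvd hp hq hpq)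
        have op := hp.odd_of_ne_two hp2
        have oq := hq.odd_of_ne_two hq2
        rcases chi4_cases hp hp2 with h | h <;> rcases chi4_cases hq hq2 with h' | h'
        · rw [h.2, h'.2, jacobiSym.quadratic_reciprocity_one_mod_four h.1 oq]
          rcases jj with jj | jj <;> rw [jj] <;> decide
        · rw [h.2, h'.2, jacobiSym.quadratic_reciprocity_one_mod_four h.1 oq]
          rcases jj with jj | jj <;> rw [jj] <;> decide
        · rw [h.2, h'.2, ← jacobiSym.quadratic_reciprocity_one_mod_four h'.1 op]
          rcases jj with jj | jj <;> rw [jj] <;> decide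
        · rw [h.2, h'.2, jacobiSym.quadratic_reciprocity_three_mod_four h.1 h'.1]
          rcases jj with jj | jj <;> rw [jj] <;> decide

lemma prod_formula_aux {q : ℕ} (hq : q.Prime) (S : Finset ℕ) (hS : ∀ l ∈ S, l.Prime)
    (h2 : 2 ∈ S) (hqS : q ∈ S) (a : ℕ) : a ≠ 0 → (∀ l : ℕ, l.Prime → l ∣ a → l ∈ S) →
    ∏ l ∈ S, hs l a q = 1 := by
  induction a using Nat.recOnMul with
  | zero => intro h; exact absurd rfl h
  | one =>
    intro _ _
    apply Finset.prod_eq_one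
    intro l hl
    simpa using hs_one (hS l hl) (by exact_mod_cast hq.ne_zero)
  | prime p hp => intro _ h; exact prod_prime hp hq S hS h2 (h p hp dvd_rfl) hqS
  | mul a b iha ihb =>
    intro h0 h
    have ha : a ≠ 0 := left_ne_zero_of_mul h0
    have hb : b ≠ 0 := right_ne_zero_of_mul h0
    have := iha ha (fun l hl hd => h l hl (hd.mul_right _))
    have h' := ihb hb (fun l hl hd => h l hl (hd.mul_left _))
    rw [Finset.prod_congr rfl (g := fun l => hs l a q * hs l b q), Finset.prod_mul_distrib, this, h']
    · rfl
    · intro l hl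
      push_cast
      exact hs_mul_left (hS l hl) (by exact_mod_cast ha) (by exact_mod_cast hb)
        (by exact_mod_cast hq.ne_zero)

lemma prod_formula (S : Finset ℕ) (hS : ∀ l ∈ S, l.Prime) (h2 : 2 ∈ S) (a b : ℕ) (ha : a ≠ 0)
    (haS : ∀ l : ℕ, l.Prime → l ∣ a → l ∈ S) : b ≠ 0 → (∀ l : ℕ, l.Prime → l ∣ b → l ∈ S) →
    ∏ l ∈ S, hs l a b = 1 := by
  induction b using Nat.recOnMul with
  | zero => intro h; exact absurd rfl h
  | one =>
    intro _ _
    apply Finset.prod_eq_one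
    intro l hl
    rw [hs_symm]
    simpa using hs_one (hS l hl) (by exact_mod_cast ha)
  | prime p hp => intro _ h; exact prod_formula_aux hp S hS h2 (h p hp dvd_rfl) a ha haS
  | mul c b iha ihb =>
    intro h0 h
    have hc : c ≠ 0 := left_ne_zero_of_mul h0
    have hb : b ≠ 0 := right_ne_zero_of_mul h0
    have := iha hc (fun l hl hd => h l hl (hd.mul_right _))
    have h' := ihb hb (fun l hl hd => h l hl (hd.mul_left _))
    rw [Finset.prod_congr rfl (g := fun l => hs l a c * hs l a b), Finset.prod_mul_distrib, this, h']
    · rfl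
    · intro l hl
      push_cast
      exact hs_mul_right (hS l hl) (by exact_mod_cast ha) (by exact_mod_cast hc)
        (by exact_mod_cast hb)

lemma jac_sq {p : ℕ} (hp : p.Prime) {a t : ℤ} (ha : ¬ (p : ℤ) ∣ a) (h : (p : ℤ) ∣ t * t - a) :
    jacobiSym a p = 1 := by
  have ht : ¬ (p : ℤ) ∣ t := by
    intro h'
    apply ha
    have := dvd_sub (h'.mul_right t) h
    simpa using this
  have e : jacobiSym (t * t) p = jacobiSym a p :=
    jacobiSym.mod_left' ((Int.emod_emod_of_dvd _ dvd_rfl).symm.trans (by simpa using Int.emod_eq_emod_iff_emod_sub_eq_zero.2 (Int.emod_eq_zero_of_dvd h)))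
  rw [← e, jacobiSym.mul_left]
  rcases jac_unit hp ht with h | h <;> rw [h] <;> rfl

lemma steinberg {p : ℕ} (hp : p.Prime) (h2 : p ≠ 2) {a t : ℤ} (ha : Squarefree a)
    (h0 : t * t - a ≠ 0) : hs p a (t * t - a) = 1 := by
  have ha0 : a ≠ 0 := ha.ne_zero
  by_cases hpa : (p : ℤ) ∣ a
  · obtain ⟨a', rfl⟩ := hpa
    have ha' : ¬ (p : ℤ) ∣ a' := by
      rintro ⟨c, rfl⟩
      have := ha p ⟨c, by ring⟩
      exact (Nat.prime_iff_prime_int.mp hp).not_isUnit this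
    obtain ⟨v1, u1⟩ := vu_unique hp (a := p * a') (k := 1) (w := a') (by ring) ha'
    by_cases hpt : (p : ℤ) ∣ t
    · obtain ⟨t', rfl⟩ := hpt
      have hw : ¬ (p : ℤ) ∣ p * (t' * t') - a' := by
        intro h
        exact ha' ((dvd_sub_right (dvd_mul_right _ _)).1 h)
      obtain ⟨v2, u2⟩ := vu_unique hp (a := p * t' * (p * t') - p * a') (k := 1)
        (w := p * (t' * t') - a') (by ring) hw
      have e : jacobiSym (p * (t' * t') - a') p = jacobiSym (-1 * a') p := by
        apply jacobiSym.mod_left'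
        apply Int.emod_eq_emod_iff_emod_sub_eq_zero.2
        apply Int.emod_eq_zero_of_dvd
        exact ⟨t' * t', by ring⟩
      unfold hs
      rw [if_neg h2, v1, u1, v2, u2, e, jacobiSym.mul_left]
      have h3 : jacobiSym (-1) p = 1 ∨ jacobiSym (-1) p = -1 := by
        apply jac_unit hp
        rw [Int.dvd_neg, ← Nat.cast_one, Int.natCast_dvd_natCast, Nat.dvd_one]
        exact hp.ne_one
      rcases jac_unit hp ha' with h | h <;> rcases h3 with h3 | h3 <;> rw [h, h3] <;> decide
    · have hw : ¬ (p : ℤ) ∣ t * t - p * a' := by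
        intro h
        have := (dvd_sub_left (dvd_mul_right (p : ℤ) a')).1 h
        rcases (Nat.prime_iff_prime_int.mp hp).dvd_or_dvd this with h | h <;> contradiction
      obtain ⟨v2, u2⟩ := vu_unit hp hw
      unfold hs
      rw [if_neg h2, v1, u1, v2, u2, jac_sq (t := t) hp hw ⟨a', by ring⟩]; simp
  · obtain ⟨v1, u1⟩ := vu_unit hp hpa
    by_cases hd : (p : ℤ) ∣ t * t - a
    · unfold hs
      rw [if_neg h2, v1, u1, jac_sq hp hpa hd]; simp
    · exact hs_unit hp h2 hpa hd

lemma sq_mod_local {p : ℕ} (hp : p.Prime) {a b : ℤ} (hb : Squarefree b) (hpb : (p : ℤ) ∣ b)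
    (h : p ≠ 2 → hs p a b = 1) : ∃ t : ℕ, (p : ℤ) ∣ t * t - a := by
  have := Fact.mk hp
  by_cases hpa : (p : ℤ) ∣ a
  · exact ⟨0, by simpa using hpa⟩
  by_cases h2 : p = 2
  · subst h2
    refine ⟨1, ?_⟩
    push_cast at *
    omega
  · have := h h2
    obtain ⟨b', rfl⟩ := hpb
    have hb' : ¬ (p : ℤ) ∣ b' := by
      rintro ⟨c, rfl⟩
      have := hb p ⟨c, by ring⟩
      exact (Nat.prime_iff_prime_int.mp hp).not_isUnit this
    obtain ⟨v1, u1⟩ := vu_unique hp (a := p * b') (k := 1) (w := b') (by ring) hb'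
    obtain ⟨v2, u2⟩ := vu_unit hp hpa
    unfold hs at this
    rw [if_neg h2, v1, u1, v2, u2] at this
    simp at this
    obtain ⟨r, hr⟩ := ZMod.isSquare_of_jacobiSym_eq_one this
    refine ⟨r.val, ?_⟩
    rw [← ZMod.intCast_zmod_eq_zero_iff_dvd _ p]
    push_cast
    rw [ZMod.natCast_zmod_val, hr, sub_self]

lemma sq_mod {n : ℕ} (hn : Squarefree n) {a : ℤ}
    (h : ∀ p : ℕ, p.Prime → p ∣ n → ∃ t : ℕ, (p : ℤ) ∣ t * t - a) :
    ∃ t : ℤ, (n : ℤ) ∣ t * t - a := by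
  have h' : ∀ p : ℕ, ∃ t : ℕ, p.Prime → p ∣ n → (p : ℤ) ∣ t * t - a := by
    intro p
    by_cases hh : p.Prime ∧ p ∣ n
    · obtain ⟨t, ht⟩ := h p hh.1 hh.2
      exact ⟨t, fun _ _ => ht⟩
    · exact ⟨0, fun h1 h2 => absurd ⟨h1, h2⟩ hh⟩
  choose f hf using h'
  obtain ⟨k, hk⟩ := Nat.chineseRemainderOfFinset f id n.primeFactors
    (fun i hi => (Nat.prime_of_mem_primeFactors hi).ne_zero)
    (fun i hi j hj hij => (Nat.coprime_primes (Nat.prime_of_mem_primeFactors hi)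
      (Nat.prime_of_mem_primeFactors hj)).2 hij)
  refine ⟨k, ?_⟩
  rw [← Nat.prod_primeFactors_of_squarefree hn]
  push_cast
  apply Finset.prod_dvd_of_coprime
  · intro i hi j hj hij
    exact Nat.isCoprime_iff_coprime.2 ((Nat.coprime_primes (Nat.prime_of_mem_primeFactors hi)
      (Nat.prime_of_mem_primeFactors hj)).2 hij)
  · intro p hp
    have h1 := hf p (Nat.prime_of_mem_primeFactors hp) (Nat.dvd_of_mem_primeFactors hp)
    have h2 : (p : ℤ) ∣ k - f p := by
      have := (hk p hp).symm
      exact (Nat.modEq_iff_dvd).1 this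
    have : (k : ℤ) * k - a = (k - f p) * (k + f p) + (f p * f p - a) := by ring
    rw [this]
    exact dvd_add (h2.mul_right _) h1

def Sol (a b : ℤ) : Prop :=
  ∃ x y z : ℤ, ¬ (x = 0 ∧ y = 0 ∧ z = 0) ∧ z * z = a * (x * x) + b * (y * y)

lemma Sol.symm {a b : ℤ} (h : Sol a b) : Sol b a := by
  obtain ⟨x, y, z, h1, h2⟩ := h
  exact ⟨y, x, z, by tauto, by linarith⟩

lemma int_sqfree_part {c : ℤ} (hc : c ≠ 0) : ∃ d m : ℤ, Squarefree d ∧ m ≠ 0 ∧ c = d * (m * m) := by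
  obtain ⟨d, m, h1, h2⟩ := Nat.sq_mul_squarefree c.natAbs
  have hm : m ≠ 0 := by
    rintro rfl
    simp at h1
    exact hc (by omega)
  refine ⟨c.sign * d, m, ?_, by exact_mod_cast hm, ?_⟩
  · rw [← Int.squarefree_natAbs, Int.natAbs_mul, Int.natAbs_sign_of_ne_zero hc]
    simpa using h2
  · conv_lhs => rw [← Int.sign_mul_natAbs c, ← h1]
    push_cast; ring

lemma legendre (n : ℕ) : ∀ a b : ℤ, Squarefree a → Squarefree b → a.natAbs + b.natAbs ≤ n →
    ¬ (a < 0 ∧ b < 0) → (∀ p : ℕ, p.Prime → p ≠ 2 → hs p a b = 1) → Sol a b := by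
  induction n with
  | zero =>
    intro a b ha _ h
    have := ha.ne_zero
    omega
  | succ n ih =>
    have main : ∀ a b : ℤ, Squarefree a → Squarefree b → a.natAbs + b.natAbs ≤ n + 1 →
      ¬ (a < 0 ∧ b < 0) → (∀ p : ℕ, p.Prime → p ≠ 2 → hs p a b = 1) → a.natAbs ≤ b.natAbs →
      Sol a b := by
      intro a b ha hb hab hneg hloc hle
      have ha0 := ha.ne_zero
      have hb0 := hb.ne_zero
      by_cases hb1 : b.natAbs ≤ 1
      · by_cases h1 : a = 1
        · exact ⟨1, 0, 1, by simp, by rw [h1]; ring⟩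
        · have : b = 1 := by omega
          exact ⟨0, 1, 1, by simp, by rw [this]; ring⟩
      obtain ⟨t0, ht0⟩ := sq_mod (n := b.natAbs) (a := a) (Int.squarefree_natAbs.2 hb) (by
        intro p hp hpb
        exact sq_mod_local hp hb (Int.natCast_dvd.2 hpb) (hloc p hp))
      rw [Int.natAbs_dvd] at ht0
      -- reduce t
      obtain ⟨t, ht, htb⟩ : ∃ t : ℤ, b ∣ t * t - a ∧ 2 * t.natAbs ≤ b.natAbs := by
        refine ⟨Int.bmod t0 b.natAbs, ?_, ?_⟩
        · have h1 : b ∣ Int.bmod t0 b.natAbs - t0 := by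
            rw [← Int.natAbs_dvd]
            exact Int.dvd_bmod_sub_self
          have : (Int.bmod t0 b.natAbs) * (Int.bmod t0 b.natAbs) - a =
            (Int.bmod t0 b.natAbs - t0) * (Int.bmod t0 b.natAbs + t0) + (t0 * t0 - a) := by ring
          rw [this]
          exact dvd_add (h1.mul_right _) ht0
        · have h1 := Int.le_bmod (x := t0) (m := b.natAbs) (by omega)
          have h2 := Int.bmod_le (x := t0) (m := b.natAbs) (by omega)
          omega
      by_cases hta : t * t - a = 0
      · exact ⟨1, 0, t, by simp, by linarith⟩
      obtain ⟨c, hc⟩ := ht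
      have hc0 : c ≠ 0 := by rintro rfl; simp at hc; exact hta hc
      obtain ⟨d, m, hd, hm, rfl⟩ := int_sqfree_part hc0
      have hd0 := hd.ne_zero
      -- size
      have hsize : d.natAbs < b.natAbs := by
        have e1 : |b| * (|d| * (|m| * |m|)) = |t * t - a| := by rw [hc]; simp [abs_mul]
        have e2 : |t * t - a| ≤ |t| * |t| + |a| := by
          rw [← abs_mul]; exact abs_sub _ _
        have e3 : 2 * |t| ≤ |b| := by rw [Int.abs_eq_natAbs, Int.abs_eq_natAbs]; omega
        have e4 : |a| ≤ |b| := by rw [Int.abs_eq_natAbs, Int.abs_eq_natAbs]; omega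
        have e5 : 2 ≤ |b| := by rw [Int.abs_eq_natAbs]; omega
        have e6 : 1 ≤ |m| := Int.one_le_abs hm
        have e7 : 0 ≤ |t| := abs_nonneg _
        have e8 : 1 ≤ |d| := Int.one_le_abs hd0
        have : |d| < |b| := by
          by_contra hcon
          push Not at hcon
          have f1 : |d| ≤ |d| * (|m| * |m|) := by nlinarith [mul_le_mul e6 e6 zero_le_one (by omega)]
          have f2 : |b| * |b| ≤ |t| * |t| + |a| := by nlinarith
          nlinarith
        rw [Int.abs_eq_natAbs, Int.abs_eq_natAbs] at this
        omega
      have hsol : Sol a d := by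
        apply ih a d ha hd (by omega)
        · rintro ⟨h1, h2⟩
          have hbp : 0 < b := by
            rcases lt_or_gt_of_ne hb0 with h | h
            · exact absurd ⟨h1, h⟩ hneg
            · exact h
          have : 0 < t * t - a := by nlinarith [mul_self_nonneg t]
          rw [hc] at this
          have hmm : 0 < m * m := mul_self_pos.2 hm
          have : b * (d * (m * m)) < 0 := by
            apply mul_neg_of_pos_of_neg hbp
            exact mul_neg_of_neg_of_pos h2 hmm
          linarith
        · intro p hp hp2
          have h1 := hloc p hp hp2
          have h3 := steinberg hp hp2 ha hta
          rw [hc, hs_mul_right hp ha0 hb0 hc0, hs_mul_right hp ha0 hd0 (mul_ne_zero hm hm), h1,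
            hs_symm p a (m * m), hs_sq hp hm ha0] at h3
          simpa using h3
      obtain ⟨x, y, z, hnt, hxyz⟩ := hsol
      by_cases hy : y = 0
      · subst hy
        exact ⟨x, 0, z, hnt, by linarith⟩
      · refine ⟨t * x + z, m * d * y, t * z + a * x, ?_, ?_⟩
        · rintro ⟨_, h, _⟩
          exact (mul_ne_zero (mul_ne_zero hm hd0) hy) h
        · have : b * (m * d * y * (m * d * y)) = (b * (d * (m * m))) * (d * (y * y)) := by ring
          rw [this, ← hc]
          have : d * (y * y) = z * z - a * (x * x) := by linarith
          rw [this]; ring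
    intro a b ha hb hab hneg hloc
    rcases le_total a.natAbs b.natAbs with h | h
    · exact main a b ha hb hab hneg hloc h
    · exact (main b a hb ha (by omega) (by tauto) (by
        intro p hp hp2; rw [hs_symm]; exact hloc p hp hp2) h).symm

/-- positive version, over ℚ: `a x² + b y² = 1`. -/
lemma legendre_pos {a b : ℤ} (ha : 0 < a) (hb : 0 < b)
    (hloc : ∀ p : ℕ, p.Prime → hs p a b = 1) :
    ∃ x y : ℚ, (a : ℚ) * x ^ 2 + b * y ^ 2 = 1 := by
  obtain ⟨a', m, ha', hm, rfl⟩ := int_sqfree_part ha.ne'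
  obtain ⟨b', k, hb', hk, rfl⟩ := int_sqfree_part hb.ne'
  have hmm : 0 < m * m := mul_self_pos.2 hm
  have hkk : 0 < k * k := mul_self_pos.2 hk
  have ha1 : 0 < a' := pos_of_mul_pos_left ha hmm.le
  have hb1 : 0 < b' := pos_of_mul_pos_left hb hkk.le
  obtain ⟨x, y, z, hnt, h⟩ := legendre _ a' b' ha' hb' le_rfl (by omega) (by
    intro p hp _
    have := hloc p hp
    rw [hs_mul_right hp ha.ne' hb1.ne' hkk.ne', hs_symm p _ (k * k), hs_sq hp hk ha.ne',
      hs_mul_left hp ha1.ne' hmm.ne' hb1.ne', hs_sq hp hm hb1.ne'] at this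
    simpa using this)
  have hz : z ≠ 0 := by
    rintro rfl
    have h1 : x = 0 := by
      by_contra hx
      have : 0 < x * x := mul_self_pos.2 hx
      nlinarith [mul_self_nonneg y, mul_pos ha1 this, mul_nonneg hb1.le (mul_self_nonneg y)]
    have h2 : y = 0 := by
      by_contra hx
      have : 0 < y * y := mul_self_pos.2 hx
      nlinarith [mul_pos hb1 this, mul_nonneg ha1.le (mul_self_nonneg x)]
    exact hnt ⟨h1, h2, rfl⟩
  refine ⟨x / (m * z), y / (k * z), ?_⟩
  have hzq : (z : ℚ) ≠ 0 := by exact_mod_cast hz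
  have hmq : (m : ℚ) ≠ 0 := by exact_mod_cast hm
  have hkq : (k : ℚ) ≠ 0 := by exact_mod_cast hk
  have hq : (z : ℚ) * z = a' * (x * x) + b' * (y * y) := by exact_mod_cast h
  push_cast
  field_simp
  linarith

def Same (p : ℕ) (x y : ℤ) : Prop :=
  vv p x % 2 = vv p y % 2 ∧ if p = 2 then
    ZMod.χ₈ (uu 2 x : ℤ) = ZMod.χ₈ (uu 2 y : ℤ) ∧ ZMod.χ₄ (uu 2 x : ℤ) = ZMod.χ₄ (uu 2 y : ℤ)
  else jacobiSym (uu p x) p = jacobiSym (uu p y) p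

lemma pow_par {x : ℤ} (hx : x = 1 ∨ x = -1) {m n : ℕ} (h : m % 2 = n % 2) : x ^ m = x ^ n := by
  rcases hx with rfl | rfl
  · simp
  · rw [neg_one_pow_eq_pow_mod_two, h, ← neg_one_pow_eq_pow_mod_two]

lemma jac_neg_one {p : ℕ} (hp : p.Prime) : jacobiSym (-1) p = 1 ∨ jacobiSym (-1) p = -1 := by
  apply jac_unit hp
  rw [Int.dvd_neg, ← Nat.cast_one, Int.natCast_dvd_natCast, Nat.dvd_one]
  exact hp.ne_one

lemma hs_congr {p : ℕ} (hp : p.Prime) {a x y : ℤ} (ha : a ≠ 0)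
    (h : Same p x y) : hs p a x = hs p a y := by
  unfold Same at h
  unfold hs
  split_ifs at h ⊢ with h2
  · subst h2
    obtain ⟨h1, h8, h4⟩ := h
    rw [h8, h4, pow_par (chi8_unit (vu_spec hp ha).2) h1]
  · obtain ⟨h1, h3⟩ := h
    rw [h3, pow_par (jac_unit hp (vu_spec hp ha).2) h1]
    congr 2
    rw [pow_mul, pow_mul]
    apply pow_par _ h1
    rcases jac_neg_one hp with h | h <;> rw [h]
    · simp
    · exact neg_one_pow_eq_or ℤ _

lemma hs_congr2 {p : ℕ} (hp : p.Prime) {a b x y : ℤ} (ha : a ≠ 0) (hy : y ≠ 0)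
    (h : Same p x y) (h' : Same p a b) : hs p a x = hs p b y := by
  rw [hs_congr hp ha h, hs_symm, hs_congr hp hy h', hs_symm]

lemma hs_expand {p : ℕ} (hp : p.Prime) {a b t : ℤ} (ha : a ≠ 0) (hb : b ≠ 0) (ht : t ≠ 0) :
    hs p (a * t) (b * t) = hs p a b * hs p a t * hs p t b * hs p t t := by
  rw [hs_mul_left hp ha ht (mul_ne_zero hb ht), hs_mul_right hp ha hb ht, hs_mul_right hp ht hb ht]
  ring

lemma hs_expand_congr {p : ℕ} (hp : p.Prime) {a b t u : ℤ} (ha : a ≠ 0) (hb : b ≠ 0) (ht : t ≠ 0)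
    (hu : u ≠ 0) (h : Same p t u) : hs p (a * t) (b * t) = hs p (a * u) (b * u) := by
  rw [hs_expand hp ha hb ht, hs_expand hp ha hb hu, hs_congr hp ha h, hs_symm p t b,
    hs_congr hp hb h, hs_symm p b u, hs_congr2 hp ht hu h h]

def bs (b : Bool) : ℤ := if b then -1 else 1
lemma bs_xor (a b : Bool) : bs (a ^^ b) = bs a * bs b := by revert a b; decide
lemma bs_one {a : Bool} (h : a = false) : bs a = 1 := by subst h; rfl

def F1 (c : Bool) (x y : Bool × Bool) : Bool :=
  (c && x.1 && y.1) ^^ (x.2 && y.1) ^^ (y.2 && x.1)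
def F2 (x y : Bool × Bool × Bool) : Bool :=
  (x.2.1 && y.1) ^^ (y.2.1 && x.1) ^^ (x.2.2 && y.2.2)

lemma dec1 : ∀ c a b d e, ∃ t s, (F1 c a b ^^ F1 c a t ^^ F1 c t b ^^ F1 c t t) = false ∧
   (F1 c d e ^^ F1 c d s ^^ F1 c s e ^^ F1 c s s) = false ∧ F1 c t s = false := by decide +kernel

lemma dec2a : ∀ a b : Bool × Bool × Bool, ∃ α : Bool × Bool × Bool,
    (α = (false, false, false) → F2 a b = false) ∧
    ∀ t, (F2 a b ^^ F2 a t ^^ F2 t b ^^ F2 t t) = (F2 t α ^^ F2 a b) := by decide +kernel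

lemma dec2b : ∀ (α β : Bool × Bool × Bool) (ε δ : Bool), (α = (false, false, false) → ε = false) →
    (β = (false, false, false) → δ = false) →
    ∃ t s, (F2 t α ^^ ε) = false ∧ (F2 s β ^^ δ) = false ∧ F2 t s = false := by decide +kernel

lemma dec2 (a b d e : Bool × Bool × Bool) : ∃ t s,
    (F2 a b ^^ F2 a t ^^ F2 t b ^^ F2 t t) = false ∧
    (F2 d e ^^ F2 d s ^^ F2 s e ^^ F2 s s) = false ∧ F2 t s = false := by
  obtain ⟨α, h1, h2⟩ := dec2a a b
  obtain ⟨β, h3, h4⟩ := dec2a d e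
  obtain ⟨t, s, h⟩ := dec2b α β _ _ h1 h3
  exact ⟨t, s, by rw [h2]; exact h.1, by rw [h4]; exact h.2.1, h.2.2⟩

/-- abstract local lemma -/
lemma local_abs {p : ℕ} (hp : p.Prime) {V : Type} (F : V → V → Bool) (rep : V → ℕ)
    (hrep : ∀ v, rep v ≠ 0) (hcl : ∀ a : ℤ, a ≠ 0 → ∃ v, Same p a (rep v))
    (hF : ∀ v w, hs p (rep v) (rep w) = bs (F v w))
    (hdec : ∀ a b d e, ∃ t s, (F a b ^^ F a t ^^ F t b ^^ F t t) = false ∧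
      (F d e ^^ F d s ^^ F s e ^^ F s s) = false ∧ F t s = false)
    {a b d e : ℤ} (ha : a ≠ 0) (hb : b ≠ 0) (hd : d ≠ 0) (he : e ≠ 0) :
    ∃ t s : ℕ, t ≠ 0 ∧ s ≠ 0 ∧ hs p (a * t) (b * t) = 1 ∧ hs p (d * s) (e * s) = 1 ∧
      hs p t s = 1 := by
  obtain ⟨a', ha'⟩ := hcl a ha
  obtain ⟨b', hb'⟩ := hcl b hb
  obtain ⟨d', hd'⟩ := hcl d hd
  obtain ⟨e', he'⟩ := hcl e he
  obtain ⟨t, s, h1, h2, h3⟩ := hdec a' b' d' e'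
  have z : ∀ v, (rep v : ℤ) ≠ 0 := fun v => by exact_mod_cast hrep v
  have sm : ∀ x, Same p x x := by intro x; unfold Same; simp
  refine ⟨rep t, rep s, hrep t, hrep s, ?_, ?_, ?_⟩
  · rw [hs_expand hp ha hb (z t), hs_congr2 hp ha (z b') hb' ha', hs_congr2 hp ha (z t) (sm _) ha',
      hs_congr2 hp (z t) (z b') hb' (sm _), hF, hF, hF, hF, ← bs_xor, ← bs_xor, ← bs_xor]
    apply bs_one
    simpa only [Bool.xor_assoc] using h1
  · rw [hs_expand hp hd he (z s), hs_congr2 hp hd (z e') he' hd', hs_congr2 hp hd (z s) (sm _) hd',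
      hs_congr2 hp (z s) (z e') he' (sm _), hF, hF, hF, hF, ← bs_xor, ← bs_xor, ← bs_xor]
    apply bs_one
    simpa only [Bool.xor_assoc] using h2
  · rw [hF]; exact bs_one h3

lemma local_two {a b d e : ℤ} (ha : a ≠ 0) (hb : b ≠ 0) (hd : d ≠ 0) (he : e ≠ 0) :
    ∃ t s : ℕ, t ≠ 0 ∧ s ≠ 0 ∧ hs 2 (a * t) (b * t) = 1 ∧ hs 2 (d * s) (e * s) = 1 ∧
      hs 2 t s = 1 := by
  let un : Bool × Bool → ℕ := fun v => if v.1 then (if v.2 then 3 else 5) else (if v.2 then 7 else 1)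
  have hun : ∀ v, ¬ ((2 : ℕ) : ℤ) ∣ (un v : ℤ) ∧ ZMod.χ₈ ((un v : ℤ) : ZMod 8) = bs v.1 ∧
      ZMod.χ₄ ((un v : ℤ) : ZMod 4) = bs v.2 := by decide
  let rep : Bool × Bool × Bool → ℕ := fun v => 2 ^ (if v.1 then 1 else 0) * un v.2
  have hr : ∀ v, vv 2 (rep v) = (if v.1 then 1 else 0) ∧ uu 2 (rep v) = un v.2 := by
    intro v
    exact vu_unique Nat.prime_two (by simp [rep]) (hun v.2).1
  apply local_abs Nat.prime_two F2 rep _ _ _ dec2 ha hb hd he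
  · decide
  · intro x hx
    have hu := (vu_spec Nat.prime_two hx).2
    refine ⟨(decide (vv 2 x % 2 = 1), decide (ZMod.χ₈ (uu 2 x : ℤ) = -1),
      decide (ZMod.χ₄ (uu 2 x : ℤ) = -1)), ?_, ?_⟩
    · rw [(hr _).1]
      rcases Nat.mod_two_eq_zero_or_one (vv 2 x) with h | h <;> simp [h]
    · rw [if_pos rfl, (hr _).2, (hun _).2.1, (hun _).2.2]
      rcases chi8_unit hu with h | h <;> rcases chi4_unit hu with h' | h' <;> rw [h, h'] <;> simp [bs]
  · intro v w
    unfold hs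
    rw [if_pos rfl, (hr v).1, (hr v).2, (hr w).1, (hr w).2, (hun _).2.1, (hun _).2.2,
      (hun _).2.1, (hun _).2.2]
    revert v w
    clear hr
    decide

lemma local_odd {p : ℕ} (hp : p.Prime) (h2 : p ≠ 2) {a b d e : ℤ} (ha : a ≠ 0) (hb : b ≠ 0)
    (hd : d ≠ 0) (he : e ≠ 0) :
    ∃ t s : ℕ, t ≠ 0 ∧ s ≠ 0 ∧ hs p (a * t) (b * t) = 1 ∧ hs p (d * s) (e * s) = 1 ∧
      hs p t s = 1 := by
  have := Fact.mk hp
  obtain ⟨n, hn⟩ : ∃ n : ℕ, jacobiSym n p = -1 := by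
    obtain ⟨r, hr⟩ := FiniteField.exists_nonsquare (F := ZMod p) (by
      rw [ZMod.ringChar_zmod_n]; exact h2)
    refine ⟨r.val, ?_⟩
    apply ZMod.nonsquare_iff_jacobiSym_eq_neg_one.2
    simpa using hr
  have hnd : ¬ (p : ℤ) ∣ n := by
    intro h
    have e : jacobiSym n p = 0 := by
      rw [jacobiSym.mod_left, Int.emod_eq_zero_of_dvd h, jacobiSym.zero_left hp.one_lt]
    rw [e] at hn; norm_num at hn
  have h1d : ¬ (p : ℤ) ∣ 1 := by
    rw [← Nat.cast_one, Int.natCast_dvd_natCast, Nat.dvd_one]; exact hp.ne_one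
  let un : Bool → ℕ := fun v => if v then n else 1
  have hun : ∀ v, ¬ (p : ℤ) ∣ (un v : ℤ) ∧ jacobiSym (un v) p = bs v := by
    intro v
    cases v
    · simpa [un, bs] using h1d
    · simpa [un, bs] using ⟨hnd, hn⟩
  let rep : Bool × Bool → ℕ := fun v => p ^ (if v.1 then 1 else 0) * un v.2
  have hr : ∀ v, vv p (rep v) = (if v.1 then 1 else 0) ∧ uu p (rep v) = un v.2 := by
    intro v
    exact vu_unique hp (by simp [rep]) (hun v.2).1
  apply local_abs hp (F1 (decide (jacobiSym (-1) p = -1))) rep _ _ _ (dec1 _) ha hb hd he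
  · intro v
    apply mul_ne_zero (pow_ne_zero _ hp.ne_zero)
    intro h
    have := (hun v.2).1
    rw [h] at this; simp at this
  · intro x hx
    have hu := (vu_spec hp hx).2
    refine ⟨(decide (vv p x % 2 = 1), decide (jacobiSym (uu p x) p = -1)), ?_, ?_⟩
    · rw [(hr _).1]
      rcases Nat.mod_two_eq_zero_or_one (vv p x) with h | h <;> simp [h]
    · rw [if_neg h2, (hr _).2, (hun _).2]
      rcases jac_unit hp hu with h | h <;> rw [h] <;> simp [bs]
  · intro v w
    unfold hs
    rw [if_neg h2, (hr v).1, (hr v).2, (hr w).1, (hr w).2, (hun _).2, (hun _).2]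
    have := jac_neg_one hp
    generalize jacobiSym (-1) p = c at *
    clear hr
    rcases this with rfl | rfl <;> revert v w <;> decide

lemma local_lemma {p : ℕ} (hp : p.Prime) {a b d e : ℤ} (ha : a ≠ 0) (hb : b ≠ 0)
    (hd : d ≠ 0) (he : e ≠ 0) :
    ∃ t s : ℕ, t ≠ 0 ∧ s ≠ 0 ∧ hs p (a * t) (b * t) = 1 ∧ hs p (d * s) (e * s) = 1 ∧
      hs p t s = 1 := by
  by_cases h2 : p = 2
  · subst h2; exact local_two ha hb hd he
  · exact local_odd hp h2 ha hb hd he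

lemma dirich (S : Finset ℕ) (hS : ∀ l ∈ S, l.Prime) (x : ℕ → ℕ) (hx : ∀ l ∈ S, x l ≠ 0) :
    ∃ X q : ℕ, q.Prime ∧ q ∉ S ∧ X ≠ 0 ∧ (∀ p ∈ S, Same p X (x p)) ∧
      ∀ l : ℕ, l.Prime → l ∣ X → l ∈ insert q S := by
  -- data
  have hdat : ∀ p : ℕ, ∃ e w : ℕ, p ∈ S → x p = p ^ e * w ∧ ¬ p ∣ w := by
    intro p
    by_cases hp : p ∈ S
    · obtain ⟨e, w, h1, h2⟩ := Nat.exists_eq_pow_mul_and_not_dvd (hx p hp) p (hS p hp).ne_one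
      exact ⟨e, w, fun _ => ⟨h2, h1⟩⟩
    · exact ⟨0, 0, fun h => absurd h hp⟩
  choose e w hew using hdat
  let m : ℕ → ℕ := fun p => if p = 2 then 8 else p
  have hm : ∀ p ∈ S, ∃ k, k ≠ 0 ∧ m p = p ^ k := by
    intro p hp
    by_cases h : p = 2
    · exact ⟨3, by norm_num, by simp [m, h]⟩
    · exact ⟨1, by norm_num, by simp [m, h]⟩
  let T : ℕ → ℕ := fun p => ∏ l ∈ S.erase p, l ^ e l
  have hT : ∀ p ∈ S, ¬ p ∣ T p := by
    intro p hp h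
    obtain ⟨l, hl, hd⟩ := (Prime.dvd_finsetProd_iff (hS p hp).prime _).1 h
    have := (hS p hp).dvd_of_dvd_pow hd
    rw [Finset.mem_erase] at hl
    exact hl.1 ((Nat.prime_dvd_prime_iff_eq (hS p hp) (hS l hl.2)).1 this).symm
  have hcop : Set.Pairwise (S : Set ℕ) (Function.onFun Nat.Coprime m) := by
    intro i hi j hj hij
    obtain ⟨k, _, hk⟩ := hm i hi
    obtain ⟨k', _, hk'⟩ := hm j hj
    show Nat.Coprime (m i) (m j)
    rw [hk, hk']
    exact ((Nat.coprime_primes (hS i hi) (hS j hj)).2 hij).pow _ _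
  have hm0 : ∀ i ∈ S, m i ≠ 0 := by
    intro i hi
    obtain ⟨k, _, hk⟩ := hm i hi
    rw [hk]; exact pow_ne_zero _ (hS i hi).ne_zero
  obtain ⟨k, hk⟩ := Nat.chineseRemainderOfFinset (fun p => w p * T p) m S hm0 hcop
  have hkM : Nat.Coprime k (∏ p ∈ S, m p) := by
    apply Nat.Coprime.prod_right
    intro p hp
    obtain ⟨j, hj, hmj⟩ := hm p hp
    have h1 := hk p hp
    rw [hmj] at h1 ⊢
    apply Nat.Coprime.pow_right
    rw [Nat.coprime_comm, (hS p hp).coprime_iff_not_dvd]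
    intro hd
    have h2 : k ≡ w p * T p [MOD p] := h1.of_dvd (dvd_pow_self p hj)
    have h3 : p ∣ w p * T p := (h2.dvd_iff dvd_rfl).1 hd
    rcases (hS p hp).dvd_mul.1 h3 with h | h
    · exact (hew p hp).2 h
    · exact hT p hp h
  obtain ⟨q, hqgt, hq, hqk⟩ := Nat.forall_exists_prime_gt_and_modEq (∑ p ∈ S, p)
    (Finset.prod_ne_zero_iff.2 hm0) hkM
  have hqS : q ∉ S := by
    intro h
    have := Finset.single_le_sum (f := fun p : ℕ => p) (fun _ _ => Nat.zero_le _) h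
    omega
  have hX0 : (∏ p ∈ S, p ^ e p) * q ≠ 0 := by
    apply mul_ne_zero _ hq.ne_zero
    rw [Finset.prod_ne_zero_iff]
    intro p hp
    exact pow_ne_zero _ (hS p hp).ne_zero
  refine ⟨(∏ p ∈ S, p ^ e p) * q, q, hq, hqS, hX0, ?_, ?_⟩
  · intro p hp
    have hpp := hS p hp
    have hXe : ((((∏ p ∈ S, p ^ e p) * q : ℕ) : ℤ)) = (p : ℤ) ^ e p * ((T p : ℤ) * q) := by
      rw [← Finset.mul_prod_erase S (fun p => p ^ e p) hp]
      push_cast [T]; ring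
    have hpT : ¬ (p : ℤ) ∣ T p := by rw [Int.natCast_dvd_natCast]; exact hT p hp
    have hpw : ¬ (p : ℤ) ∣ w p := by rw [Int.natCast_dvd_natCast]; exact (hew p hp).2
    have hpq : ¬ (p : ℤ) ∣ q := prime_not_dvd hpp hq (by rintro rfl; exact hqS hp)
    have hun : ¬ (p : ℤ) ∣ (T p : ℤ) * q := by
      intro h
      rcases (Nat.prime_iff_prime_int.mp hpp).dvd_or_dvd h with h | h <;> contradiction
    obtain ⟨v1, u1⟩ := vu_unique hpp hXe hun
    obtain ⟨v2, u2⟩ := vu_unique hpp (a := (x p : ℤ)) (k := e p) (w := (w p : ℤ)) (by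
      conv_lhs => rw [(hew p hp).1]
      push_cast; rfl) hpw
    have hqm : q ≡ w p * T p [MOD m p] :=
      (hqk.of_dvd (Finset.dvd_prod_of_mem m hp)).trans (hk p hp)
    refine ⟨by rw [v1, v2], ?_⟩
    split_ifs with h2
    · subst h2
      rw [u1, u2]
      have h8 : ((q : ℕ) : ZMod 8) = ((w 2 * T 2 : ℕ) : ZMod 8) :=
        (ZMod.natCast_eq_natCast_iff _ _ _).2 (by simpa [m] using hqm)
      have h4 : ((q : ℕ) : ZMod 4) = ((w 2 * T 2 : ℕ) : ZMod 4) :=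
        (ZMod.natCast_eq_natCast_iff _ _ _).2 (Nat.ModEq.of_dvd (by norm_num)
          (show q ≡ w 2 * T 2 [MOD 8] by simpa [m] using hqm))
      have c8 := chi8_unit hpT
      have c4 := chi4_unit hpT
      push_cast at h8 h4 c8 c4 ⊢
      rw [h8, h4]
      simp only [map_mul]
      constructor
      · rcases c8 with h | h <;> rw [h] <;> ring
      · rcases c4 with h | h <;> rw [h] <;> ring
    · rw [u1, u2]
      have e1 : jacobiSym ((T p : ℤ) * q) p = jacobiSym ((T p : ℤ) * (w p * T p)) p := by
        apply jacobiSym.mod_left'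
        have : q ≡ w p * T p [MOD p] := by simpa [m, h2] using hqm
        have := this.mul_left (T p)
        have h3 := (Int.natCast_modEq_iff).2 this
        push_cast at h3
        exact h3
      rw [e1, jacobiSym.mul_left, jacobiSym.mul_left]
      rcases jac_unit hpp hpT with h | h <;> rw [h] <;> ring
  · intro l hl hd
    rw [Finset.mem_insert]
    rcases hl.dvd_mul.1 hd with h | h
    · right
      obtain ⟨p, hp, hd⟩ := (Prime.dvd_finsetProd_iff hl.prime _).1 h
      have := (Nat.prime_dvd_prime_iff_eq hl (hS p hp)).1 (hl.dvd_of_dvd_pow hd)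
      rw [this]; exact hp
    · left; exact (Nat.prime_dvd_prime_iff_eq hl hq).1 h

lemma close_up (S : Finset ℕ) (hS : ∀ l ∈ S, l.Prime) (h2 : 2 ∈ S) {r : ℕ} (hr : r.Prime)
    (hrS : r ∉ S) {a b : ℕ} (ha : a ≠ 0) (hb : b ≠ 0)
    (haS : ∀ l : ℕ, l.Prime → l ∣ a → l ∈ insert r S)
    (hbS : ∀ l : ℕ, l.Prime → l ∣ b → l ∈ insert r S)
    (h : ∀ p ∈ S, hs p a b = 1) : ∀ p : ℕ, p.Prime → hs p a b = 1 := by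
  intro p hp
  by_cases hpS : p ∈ S
  · exact h p hpS
  by_cases hpr : p = r
  · subst hpr
    have := prod_formula (insert p S) (by
      intro l hl; rcases Finset.mem_insert.1 hl with rfl | hl
      · exact hr
      · exact hS l hl) (Finset.mem_insert_of_mem h2) a b ha haS hb hbS
    rw [Finset.prod_insert hrS, Finset.prod_eq_one h, mul_one] at this
    exact this
  · have hn : p ∉ insert r S := by rw [Finset.mem_insert]; tauto
    apply hs_unit hp (by rintro rfl; exact hpS h2)
    · rw [Int.natCast_dvd_natCast]; exact fun hd => hn (haS p hp hd)
    · rw [Int.natCast_dvd_natCast]; exact fun hd => hn (hbS p hp hd)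

lemma quaternary_nat {a b c d : ℕ} (ha : a ≠ 0) (hb : b ≠ 0) (hc : c ≠ 0) (hd : d ≠ 0) :
    ∃ x y z w : ℚ, (a : ℚ) * x ^ 2 + b * y ^ 2 + c * z ^ 2 + d * w ^ 2 = 1 := by
  let S : Finset ℕ := insert 2 (a * b * c * d).primeFactors
  have h0 : a * b * c * d ≠ 0 := by positivity
  have hS : ∀ l ∈ S, l.Prime := by
    intro l hl
    rcases Finset.mem_insert.1 hl with rfl | hl
    · exact Nat.prime_two
    · exact Nat.prime_of_mem_primeFactors hl
  have h2 : 2 ∈ S := Finset.mem_insert_self _ _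
  have hdS : ∀ l : ℕ, l.Prime → l ∣ a * b * c * d → l ∈ S := by
    intro l hl hdv
    exact Finset.mem_insert_of_mem (Nat.mem_primeFactors.2 ⟨hl, hdv, h0⟩)
  have da : a ∣ a * b * c * d := ⟨b * c * d, by ring⟩
  have db : b ∣ a * b * c * d := ⟨a * c * d, by ring⟩
  have dc : c ∣ a * b * c * d := ⟨a * b * d, by ring⟩
  have dd : d ∣ a * b * c * d := ⟨a * b * c, by ring⟩
  have za : (a : ℤ) ≠ 0 := by exact_mod_cast ha
  have zb : (b : ℤ) ≠ 0 := by exact_mod_cast hb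
  have zc : (c : ℤ) ≠ 0 := by exact_mod_cast hc
  have zd : (d : ℤ) ≠ 0 := by exact_mod_cast hd
  have hl : ∀ p : ℕ, ∃ t s : ℕ, p ∈ S → t ≠ 0 ∧ s ≠ 0 ∧ hs p (a * t) (b * t) = 1 ∧
      hs p (c * s) (d * s) = 1 ∧ hs p t s = 1 := by
    intro p
    by_cases hp : p ∈ S
    · obtain ⟨t, s, h⟩ := local_lemma (hS p hp) za zb zc zd
      exact ⟨t, s, fun _ => h⟩
    · exact ⟨0, 0, fun h => absurd h hp⟩
  choose t s hts using hl
  obtain ⟨T, q, hq, hqS, hT0, hT, hTd⟩ := dirich S hS t (fun l hl => (hts l hl).1)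
  have hS' : ∀ l ∈ insert q S, l.Prime := by
    intro l hl
    rcases Finset.mem_insert.1 hl with rfl | hl
    · exact hq
    · exact hS l hl
  obtain ⟨R, r, hr, hrS, hR0, hR, hRd⟩ := dirich (insert q S) hS' (fun p => if p = q then 1 else s p)
    (by
      intro l hl
      by_cases h : l = q
      · simp [h]
      · rcases Finset.mem_insert.1 hl with h' | h'
        · exact absurd h' h
        · simpa [h] using (hts l h').2.1)
  have hRS : ∀ p ∈ S, Same p R (s p) := by
    intro p hp
    have := hR p (Finset.mem_insert_of_mem hp)
    rwa [if_neg (by rintro rfl; exact hqS hp)] at this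
  have hRq : Same q R 1 := by
    have := hR q (Finset.mem_insert_self _ _)
    simpa using this
  have zT : (T : ℤ) ≠ 0 := by exact_mod_cast hT0
  have zR : (R : ℤ) ≠ 0 := by exact_mod_cast hR0
  have E1 := close_up S hS h2 hq hqS (a := a * T) (b := b * T) (mul_ne_zero ha hT0)
    (mul_ne_zero hb hT0)
    (by
      intro l hl hdv
      rcases hl.dvd_mul.1 hdv with h | h
      · exact Finset.mem_insert_of_mem (hdS l hl (h.trans da))
      · exact hTd l hl h)
    (by
      intro l hl hdv
      rcases hl.dvd_mul.1 hdv with h | h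
      · exact Finset.mem_insert_of_mem (hdS l hl (h.trans db))
      · exact hTd l hl h)
    (by
      intro p hp
      push_cast
      rw [hs_expand_congr (hS p hp) za zb zT (by exact_mod_cast (hts p hp).1) (hT p hp)]
      exact (hts p hp).2.2.1)
  have E2 := close_up (insert q S) hS' (Finset.mem_insert_of_mem h2) hr hrS (a := c * R)
    (b := d * R) (mul_ne_zero hc hR0) (mul_ne_zero hd hR0)
    (by
      intro l hl hdv
      rcases hl.dvd_mul.1 hdv with h | h
      · exact Finset.mem_insert_of_mem (Finset.mem_insert_of_mem (hdS l hl (h.trans dc)))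
      · exact hRd l hl h)
    (by
      intro l hl hdv
      rcases hl.dvd_mul.1 hdv with h | h
      · exact Finset.mem_insert_of_mem (Finset.mem_insert_of_mem (hdS l hl (h.trans dd)))
      · exact hRd l hl h)
    (by
      intro p hp
      push_cast
      rcases Finset.mem_insert.1 hp with rfl | hp
      · rw [hs_expand_congr hq zc zd zR one_ne_zero hRq, mul_one, mul_one]
        apply hs_unit hq (by rintro rfl; exact hqS h2)
        · rw [Int.natCast_dvd_natCast]; exact fun h => hqS (hdS p hq (h.trans dc))
        · rw [Int.natCast_dvd_natCast]; exact fun h => hqS (hdS p hq (h.trans dd))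
      · rw [hs_expand_congr (hS p hp) zc zd zR (by exact_mod_cast (hts p hp).2.1) (hRS p hp)]
        exact (hts p hp).2.2.2.1)
  have E3 := close_up (insert q S) hS' (Finset.mem_insert_of_mem h2) hr hrS (a := T)
    (b := R) hT0 hR0
    (fun l hl hdv => Finset.mem_insert_of_mem (hTd l hl hdv)) hRd
    (by
      intro p hp
      rcases Finset.mem_insert.1 hp with rfl | hp
      · rw [hs_congr hq zT hRq, hs_symm, hs_one hq zT]
      · rw [hs_congr2 (hS p hp) zT (by exact_mod_cast (hts p hp).2.1) (hRS p hp) (hT p hp)]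
        exact (hts p hp).2.2.2.2)
  obtain ⟨x, y, h1⟩ := legendre_pos (by positivity) (by positivity) E1
  obtain ⟨z, w, h3⟩ := legendre_pos (by positivity) (by positivity) E2
  obtain ⟨u, v, h4⟩ := legendre_pos (by positivity) (by positivity) E3
  refine ⟨T * x * u, T * y * u, R * z * v, R * w * v, ?_⟩
  push_cast at h1 h3 h4
  linear_combination (T * u ^ 2 : ℚ) * h1 + (R * v ^ 2 : ℚ) * h3 + h4

lemma quaternary {a b c d n : ℚ} (ha : 0 < a) (hb : 0 < b) (hc : 0 < c) (hd : 0 < d) (hn : 0 < n) :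
    ∃ x y z w : ℚ, a * x ^ 2 + b * y ^ 2 + c * z ^ 2 + d * w ^ 2 = n := by
  have key : ∀ r : ℚ, 0 < r → ∃ m k : ℕ, m ≠ 0 ∧ k ≠ 0 ∧ (m : ℚ) = r * k ^ 2 := by
    intro r hr
    refine ⟨r.num.natAbs * r.den, r.den, ?_, r.den_ne_zero, ?_⟩
    · apply mul_ne_zero _ r.den_ne_zero
      have := Rat.num_pos.2 hr
      omega
    · have h1 : ((r.num.natAbs : ℕ) : ℚ) = r.num := by
        have := Rat.num_pos.2 hr
        rw [Nat.cast_natAbs, abs_of_pos this]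
      have h2 := Rat.mul_den_eq_num r
      push_cast
      rw [h1, ← h2]; ring
  obtain ⟨A, i, hA, hi, eA⟩ := key (a / n) (by positivity)
  obtain ⟨B, j, hB, hj, eB⟩ := key (b / n) (by positivity)
  obtain ⟨C, k, hC, hk, eC⟩ := key (c / n) (by positivity)
  obtain ⟨D, l, hD, hl, eD⟩ := key (d / n) (by positivity)
  obtain ⟨x, y, z, w, h⟩ := quaternary_nat hA hB hC hD
  refine ⟨i * x, j * y, k * z, l * w, ?_⟩
  rw [eA, eB, eC, eD] at h
  field_simp at h
  linear_combination h

lemma qeval_eq {m : ℕ} (Q : Matrix (Fin m) (Fin m) ℚ) (x : Fin m → ℚ) :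
    qeval Q x = Matrix.toBilin' Q x x := by
  rw [Matrix.toBilin'_apply']; rfl

def Bq : LinearMap.BilinForm ℚ (Fin 9 → ℚ) := Matrix.toBilin' q8

lemma Bq_apply (x y : Fin 9 → ℚ) : Bq x y = -(x 0 * y 0) + ∑ i : Fin 8, x i.succ * y i.succ := by
  unfold Bq
  rw [Matrix.toBilin'_apply', q8, dotProduct, Fin.sum_univ_succ]
  simp [Matrix.mulVec_diagonal, Fin.succ_ne_zero]

lemma Bq_symm (x y : Fin 9 → ℚ) : Bq x y = Bq y x := by
  rw [Bq_apply, Bq_apply]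
  congr 1
  · ring
  · exact Finset.sum_congr rfl fun i _ => mul_comm _ _

lemma Bq_pos {e w : Fin 9 → ℚ} (he : Bq e e < 0) (hw : w ≠ 0) (h : Bq w e = 0) : 0 < Bq w w := by
  rw [Bq_apply] at *
  have cs := Finset.sum_mul_sq_le_sq_mul_sq Finset.univ (fun i : Fin 8 => w i.succ)
    (fun i : Fin 8 => e i.succ)
  have e1 : ∑ i : Fin 8, e i.succ * e i.succ = ∑ i : Fin 8, e i.succ ^ 2 :=
    Finset.sum_congr rfl fun i _ => by ring
  have w1 : ∑ i : Fin 8, w i.succ * w i.succ = ∑ i : Fin 8, w i.succ ^ 2 :=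
    Finset.sum_congr rfl fun i _ => by ring
  rw [e1] at he
  rw [w1]
  have hE : 0 ≤ ∑ i : Fin 8, e i.succ ^ 2 := Finset.sum_nonneg fun i _ => sq_nonneg _
  have hW : 0 ≤ ∑ i : Fin 8, w i.succ ^ 2 := Finset.sum_nonneg fun i _ => sq_nonneg _
  have hS : ∑ i : Fin 8, w i.succ * e i.succ = w 0 * e 0 := by linarith
  rw [hS] at cs
  by_contra hcon
  push Not at hcon
  have he0 : 0 < e 0 * e 0 := by linarith
  have hw0 : w 0 = 0 := by
    by_contra hne
    have : 0 < w 0 * w 0 := mul_self_pos.2 hne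
    have h1 : (∑ i : Fin 8, w i.succ ^ 2) * (∑ i : Fin 8, e i.succ ^ 2) ≤
      (w 0 * w 0) * (∑ i : Fin 8, e i.succ ^ 2) := mul_le_mul_of_nonneg_right (by linarith) hE
    have h2 : (w 0 * w 0) * (∑ i : Fin 8, e i.succ ^ 2) < (w 0 * w 0) * (e 0 * e 0) :=
      mul_lt_mul_of_pos_left (by linarith) this
    nlinarith
  apply hw
  have hW0 : ∑ i : Fin 8, w i.succ ^ 2 = 0 := by
    apply le_antisymm _ hW
    rw [hw0] at hcon
    linarith
  rw [Finset.sum_eq_zero_iff_of_nonneg (fun i _ => sq_nonneg _)] at hW0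
  funext i
  refine Fin.cases hw0 (fun j => ?_) i
  have := hW0 j (Finset.mem_univ _)
  simpa using this

lemma ker_dim {ι : Type} [Fintype ι] (E : ι → Fin 9 → ℚ) :
    9 ≤ Module.finrank ℚ (LinearMap.ker (LinearMap.pi fun i => Bq (E i))) + Fintype.card ι := by
  have h := LinearMap.finrank_range_add_finrank_ker (LinearMap.pi fun i => Bq (E i))
  have h2 := Submodule.finrank_le (LinearMap.range (LinearMap.pi fun i => Bq (E i)))
  simp only [Module.finrank_fintype_fun_eq_card, Fintype.card_fin] at h h2
  omega

lemma rep_step {ι : Type} [Fintype ι] (E : ι → Fin 9 → ℚ) (hc : Fintype.card ι ≤ 5) (i0 : ι)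
    (hneg : Bq (E i0) (E i0) < 0) {c : ℚ} (hcp : 0 < c) :
    ∃ w, (∀ i, Bq (E i) w = 0) ∧ Bq w w = c := by
  have hd := ker_dim E
  set W := LinearMap.ker (LinearMap.pi fun i => Bq (E i)) with hW
  have hWm : ∀ w, w ∈ W ↔ ∀ i, Bq (E i) w = 0 := by
    intro w
    rw [hW, LinearMap.mem_ker, funext_iff]
    rfl
  obtain ⟨b, hb⟩ := LinearMap.BilinForm.exists_orthogonal_basis (B := Bq.restrict W)
    ⟨fun x y => Bq_symm _ _⟩
  have h4 : 4 ≤ Module.finrank ℚ W := by omega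
  let f : Fin 4 → Fin 9 → ℚ := fun i => (b (Fin.castLE h4 i) : Fin 9 → ℚ)
  have hfW : ∀ i, f i ∈ W := fun i => (b (Fin.castLE h4 i)).2
  have hf0 : ∀ i j, i ≠ j → Bq (f i) (f j) = 0 := by
    intro i j hij
    exact hb (fun h => hij (Fin.castLE_injective h4 h))
  have hfp : ∀ i, 0 < Bq (f i) (f i) := by
    intro i
    apply Bq_pos hneg
    · intro h
      exact b.ne_zero (Fin.castLE h4 i) (Subtype.ext h)
    · rw [Bq_symm]; exact (hWm _).1 (hfW i) i0
  obtain ⟨x, y, z, w, h⟩ := quaternary (hfp 0) (hfp 1) (hfp 2) (hfp 3) hcp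
  refine ⟨x • f 0 + y • f 1 + z • f 2 + w • f 3, ?_, ?_⟩
  · rw [← hWm]
    exact W.add_mem (W.add_mem (W.add_mem (W.smul_mem _ (hfW _)) (W.smul_mem _ (hfW _)))
      (W.smul_mem _ (hfW _))) (W.smul_mem _ (hfW _))
  · simp only [map_add, map_smul, LinearMap.add_apply, LinearMap.smul_apply, smul_eq_mul]
    rw [hf0 0 1 (by decide), hf0 0 2 (by decide), hf0 0 3 (by decide),
      hf0 1 0 (by decide), hf0 1 2 (by decide), hf0 1 3 (by decide),
      hf0 2 0 (by decide), hf0 2 1 (by decide), hf0 2 3 (by decide),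
      hf0 3 0 (by decide), hf0 3 1 (by decide), hf0 3 2 (by decide)]
    linear_combination h

lemma rep_family {n : ℕ} (hn : n ≤ 6) (c : Fin n → ℚ) (i0 : Fin n) (h0 : c i0 < 0)
    (hpos : ∀ i, i ≠ i0 → 0 < c i) :
    ∃ E : Fin n → Fin 9 → ℚ, ∀ i j, Bq (E i) (E j) = if i = j then c i else 0 := by
  have main : ∀ s : Finset (Fin n), i0 ∉ s → ∃ E : Fin n → Fin 9 → ℚ,
      ∀ i ∈ insert i0 s, ∀ j ∈ insert i0 s, Bq (E i) (E j) = if i = j then c i else 0 := by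
    intro s
    induction s using Finset.induction_on with
    | empty =>
      intro _
      refine ⟨fun _ => ![(c i0 - 1) / 2, (c i0 + 1) / 2, 0, 0, 0, 0, 0, 0, 0], ?_⟩
      intro i hi j hj
      simp at hi hj
      subst hi; subst hj
      rw [Bq_apply, if_pos rfl]
      simp [Fin.sum_univ_succ]
      ring
    | insert a s ha ih =>
      intro hi0
      rw [Finset.mem_insert, not_or] at hi0
      obtain ⟨E, hE⟩ := ih hi0.2
      have hcard : (insert i0 s).card ≤ 5 := by
        have h1 : (insert a (insert i0 s)).card ≤ n := by
          simpa using Finset.card_le_univ (insert a (insert i0 s))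
        rw [Finset.card_insert_of_notMem] at h1
        · omega
        · rw [Finset.mem_insert]; rintro (h | h)
          · exact hi0.1 h.symm
          · exact ha h
      have hm0 := Finset.mem_insert_self i0 s
      obtain ⟨w, hw1, hw2⟩ := rep_step (ι := ↥(insert i0 s)) (fun i => E i) (by rw [Fintype.card_coe]; exact hcard)
        ⟨i0, hm0⟩ (by show Bq (E i0) (E i0) < 0; rw [hE i0 hm0 i0 hm0, if_pos rfl]; exact h0)
        (hpos a (Ne.symm hi0.1))
      refine ⟨Function.update E a w, ?_⟩
      have hmem : ∀ i ∈ insert i0 (insert a s), i ≠ a → i ∈ insert i0 s := by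
        intro i hi hia; simp at hi ⊢; tauto
      intro i hi j hj
      by_cases hia : i = a
      · subst hia
        by_cases hja : j = i
        · subst hja; simpa using hw2
        · rw [Function.update_self, Function.update_of_ne hja, if_neg (Ne.symm hja), Bq_symm]
          exact hw1 ⟨j, hmem j hj hja⟩
      · by_cases hja : j = a
        · subst hja
          rw [Function.update_self, Function.update_of_ne hia, if_neg hia]
          exact hw1 ⟨i, hmem i hi hia⟩
        · rw [Function.update_of_ne hia, Function.update_of_ne hja]
          exact hE i (hmem i hi hia) j (hmem j hj hja)
  obtain ⟨E, hE⟩ := main (Finset.univ.erase i0) (by simp)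
  refine ⟨E, fun i j => hE i ?_ j ?_⟩ <;> simp

/-- signature analysis of a diagonalized form -/
lemma sig_diag {k : ℕ} {G : Matrix (Fin (k + 1)) (Fin (k + 1)) ℚ} (hsig : HasSignature G k 1)
    {P : Matrix (Fin (k + 1)) (Fin (k + 1)) ℚ} (hP : P.det ≠ 0) {c : Fin (k + 1) → ℚ}
    (hc : Pᵀ * G * P = Matrix.diagonal c) :
    ∃ i0, c i0 < 0 ∧ ∀ i, i ≠ i0 → 0 < c i := by
  obtain ⟨-, T, hT, hq⟩ := hsig
  set PR : Matrix (Fin (k + 1)) (Fin (k + 1)) ℝ := P.map (algebraMap ℚ ℝ) with hPR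
  have hPRdet : PR.det ≠ 0 := by
    have : PR.det = algebraMap ℚ ℝ P.det := by
      rw [RingHom.map_det]; rfl
    rw [this]
    simpa using hP
  have hG : G.map (Rat.cast : ℚ → ℝ) = G.map (algebraMap ℚ ℝ) := rfl
  have hdiag : PRᵀ * G.map (Rat.cast : ℚ → ℝ) * PR = Matrix.diagonal (fun i => (c i : ℝ)) := by
    rw [hG, hPR, ← Matrix.transpose_map, ← Matrix.map_mul, ← Matrix.map_mul, hc]
    rw [Matrix.diagonal_map (map_zero _)]; rfl
  have hval : ∀ z : Fin (k + 1) → ℝ, qeval (G.map (Rat.cast : ℚ → ℝ)) (PR *ᵥ z) =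
      ∑ i, (c i : ℝ) * z i ^ 2 := by
    intro z
    unfold qeval
    have : (PR *ᵥ z) ⬝ᵥ (G.map (Rat.cast : ℚ → ℝ) *ᵥ (PR *ᵥ z)) =
      z ⬝ᵥ ((PRᵀ * G.map (Rat.cast : ℚ → ℝ) * PR) *ᵥ z) := by
      rw [← Matrix.mulVec_mulVec, ← Matrix.mulVec_mulVec, Matrix.dotProduct_mulVec z,
        Matrix.vecMul_transpose]
    rw [this, hdiag, dotProduct]
    refine Finset.sum_congr rfl fun i _ => ?_
    rw [Matrix.mulVec_diagonal]; ring
  have surj : ∀ M : Matrix (Fin (k + 1)) (Fin (k + 1)) ℝ, M.det ≠ 0 →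
      ∀ y, ∃ x, M *ᵥ x = y := by
    intro M hM
    exact Matrix.mulVec_surjective_iff_isUnit.2 ((Matrix.isUnit_iff_isUnit_det _).2 hM.isUnit)
  have hneg : ∃ i0, c i0 < 0 := by
    by_contra hcon
    push Not at hcon
    obtain ⟨z, hz⟩ := surj PR hPRdet (T *ᵥ Pi.single (Fin.last k) 1)
    have h1 := hval z
    rw [hz, hq, Fin.sum_univ_castSucc] at h1
    have h2 : 0 ≤ ∑ i, (c i : ℝ) * z i ^ 2 := Finset.sum_nonneg fun i _ =>
      mul_nonneg (by exact_mod_cast hcon i) (sq_nonneg _)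
    rw [← h1] at h2
    simp at h2
    norm_num at h2
  obtain ⟨i, hi⟩ := hneg
  refine ⟨i, hi, ?_⟩
  intro j hj
  by_contra hcj
  push Not at hcj
  obtain ⟨u, hu⟩ := surj T hT (PR *ᵥ Pi.single i 1)
  obtain ⟨w, hw⟩ := surj T hT (PR *ᵥ Pi.single j 1)
  obtain ⟨α, β, hab, hlin⟩ : ∃ α β : ℝ, ¬ (α = 0 ∧ β = 0) ∧
      α * u (Fin.last k) + β * w (Fin.last k) = 0 := by
    by_cases h : u (Fin.last k) = 0
    · exact ⟨1, 0, by simp, by rw [h]; ring⟩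
    · exact ⟨w (Fin.last k), -u (Fin.last k), by simp [h], by ring⟩
  have e1 : T *ᵥ (α • u + β • w) = PR *ᵥ (α • Pi.single i 1 + β • Pi.single j 1) := by
    rw [Matrix.mulVec_add, Matrix.mulVec_add, Matrix.mulVec_smul, Matrix.mulVec_smul,
      Matrix.mulVec_smul, Matrix.mulVec_smul, hu, hw]
  have h1 := hq (α • u + β • w)
  rw [e1, hval] at h1
  have h2 : ∑ l, (c l : ℝ) * (α • Pi.single i 1 + β • Pi.single j 1 : Fin (k + 1) → ℝ) l ^ 2 ≤ 0 := by
    apply Finset.sum_nonpos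
    intro l _
    by_cases hl : l = i
    · subst hl
      exact mul_nonpos_of_nonpos_of_nonneg (by exact_mod_cast hi.le) (sq_nonneg _)
    · by_cases hl' : l = j
      · subst hl'
        exact mul_nonpos_of_nonpos_of_nonneg (by exact_mod_cast hcj) (sq_nonneg _)
      · simp [Pi.single_apply, hl, hl']
  rw [h1, Fin.sum_univ_castSucc] at h2
  have hlast : (α • u + β • w) (Fin.last k) = 0 := by simpa using hlin
  rw [hlast] at h2
  simp only [Fin.val_castSucc, Fin.is_lt, if_true, Fin.val_last, lt_irrefl, if_false] at h2
  have h3 : ∑ l : Fin k, (α • u + β • w) l.castSucc ^ 2 = 0 := by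
    apply le_antisymm _ (Finset.sum_nonneg fun l _ => sq_nonneg _)
    simpa using h2
  rw [Finset.sum_eq_zero_iff_of_nonneg (fun l _ => sq_nonneg _)] at h3
  have hz : α • u + β • w = 0 := by
    funext l
    refine Fin.lastCases hlast (fun m => ?_) l
    simpa using h3 m (Finset.mem_univ _)
  rw [hz, Matrix.mulVec_zero] at e1
  have hz2 : (α • Pi.single i 1 + β • Pi.single j 1 : Fin (k + 1) → ℝ) = 0 :=
    Matrix.eq_zero_of_mulVec_eq_zero hPRdet e1.symm
  apply hab
  constructor
  · have := congrFun hz2 i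
    simpa [Pi.single_apply, Ne.symm hj] using this
  · have := congrFun hz2 j
    simpa [Pi.single_apply, hj] using this

/-- `q₈` represents every nonsingular rational quadratic form of
signature `(k,1)` with `1 ≤ k ≤ 5`. -/
theorem q8_represents_small_lorentzian (k : ℕ) (hk1 : 1 ≤ k) (hk5 : k ≤ 5)
    (G : Matrix (Fin (k + 1)) (Fin (k + 1)) ℚ) (hGsymm : G.IsSymm) (hGns : G.det ≠ 0)
    (hsig : HasSignature G k 1) :
    Represents q8 G := by
  have hsymm : ∀ x y, Matrix.toBilin' G x y = Matrix.toBilin' G y x := by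
    intro x y
    rw [Matrix.toBilin'_apply', Matrix.toBilin'_apply', Matrix.dotProduct_mulVec,
      ← Matrix.mulVec_transpose, hGsymm.eq, dotProduct_comm]
  obtain ⟨b, hb⟩ := LinearMap.BilinForm.exists_orthogonal_basis (B := Matrix.toBilin' G)
    ⟨fun x y => hsymm x y⟩
  have hfr : Module.finrank ℚ (Fin (k + 1) → ℚ) = k + 1 := by simp
  let v : Module.Basis (Fin (k + 1)) ℚ (Fin (k + 1) → ℚ) := b.reindex (finCongr hfr)
  have hv : ∀ i j, i ≠ j → Matrix.toBilin' G (v i) (v j) = 0 := by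
    intro i j hij
    simp only [v, Module.Basis.reindex_apply]
    exact hb (fun h => hij ((finCongr hfr).symm.injective h))
  let c : Fin (k + 1) → ℚ := fun i => Matrix.toBilin' G (v i) (v i)
  let P : Matrix (Fin (k + 1)) (Fin (k + 1)) ℚ := Matrix.of fun a i => v i a
  have hPcol : ∀ x, P *ᵥ x = ∑ i, x i • v i := by
    intro x
    funext a
    simp [P, Matrix.mulVec, dotProduct, mul_comm]
  have hP : P.det ≠ 0 := by
    intro h
    obtain ⟨x, hx, hx0⟩ := Matrix.exists_mulVec_eq_zero_iff.2 h
    rw [hPcol] at hx0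
    exact hx (funext fun i => Fintype.linearIndependent_iff.1 v.linearIndependent x hx0 i)
  have hPc : Pᵀ * G * P = Matrix.diagonal c := by
    ext i j
    have h1 : (Pᵀ * G * P) i j = Matrix.toBilin' G (v i) (v j) := by
      rw [Matrix.toBilin'_apply', Matrix.mul_assoc]
      rfl
    rw [h1, Matrix.diagonal_apply]
    split_ifs with h
    · subst h; rfl
    · exact hv i j h
  obtain ⟨i0, hi0, hipos⟩ := sig_diag hsig hP hPc
  obtain ⟨E, hE⟩ := rep_family (by omega) c i0 hi0 hipos
  let φ : (Fin (k + 1) → ℚ) →ₗ[ℚ] (Fin 9 → ℚ) := v.constr ℚ E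
  have hφ : ∀ x y, Bq (φ x) (φ y) = Matrix.toBilin' G x y := by
    have : LinearMap.BilinForm.comp Bq φ φ = Matrix.toBilin' G := by
      apply LinearMap.BilinForm.ext_basis v
      intro i j
      rw [LinearMap.BilinForm.comp_apply]
      simp only [φ, Module.Basis.constr_basis]
      rw [hE]
      split_ifs with h
      · subst h; rfl
      · exact (hv i j h).symm
    intro x y
    rw [← this]; rfl
  have hd := ker_dim E
  rw [Fintype.card_fin] at hd
  set W := LinearMap.ker (LinearMap.pi fun i => Bq (E i)) with hW
  have hWm : ∀ w ∈ W, ∀ i, Bq (E i) w = 0 := by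
    intro w
    rw [hW, LinearMap.mem_ker, funext_iff]
    exact id
  have hm : 8 - k ≤ Module.finrank ℚ W := by omega
  let bW := Module.finBasis ℚ W
  let f : Fin (8 - k) → Fin 9 → ℚ := fun j => (bW (Fin.castLE hm j) : Fin 9 → ℚ)
  have hf : LinearIndependent ℚ f :=
    (bW.linearIndependent.map' W.subtype (Submodule.ker_subtype W)).comp _
      (Fin.castLE_injective hm)
  let ψ : (Fin (8 - k) → ℚ) →ₗ[ℚ] (Fin 9 → ℚ) := Fintype.linearCombination ℚ f
  have hψ0 : ∀ y, ψ y = 0 → y = 0 := by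
    intro y hy
    exact funext fun i => Fintype.linearIndependent_iff.1 hf y
      (by simpa [ψ, Fintype.linearCombination_apply] using hy) i
  have hψW : ∀ y, ψ y ∈ W := by
    intro y
    simp only [ψ, Fintype.linearCombination_apply]
    exact W.sum_mem fun j _ => W.smul_mem _ (bW (Fin.castLE hm j)).2
  have hcross : ∀ x y, Bq (φ x) (ψ y) = 0 := by
    intro x y
    have : φ x = ∑ i, v.repr x i • E i := by
      simp [φ, Module.Basis.constr_apply_fintype]
    rw [this]
    simp only [map_sum, map_smul, LinearMap.sum_apply, LinearMap.smul_apply]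
    exact Finset.sum_eq_zero fun i _ => by rw [hWm _ (hψW y) i, smul_zero]
  have h9 : 9 = (k + 1) + (8 - k) := by omega
  let Φ : (Fin 9 → ℚ) →ₗ[ℚ] (Fin 9 → ℚ) :=
    φ ∘ₗ LinearMap.funLeft ℚ ℚ (fun i => Fin.cast h9.symm (Fin.castAdd (8 - k) i)) +
    ψ ∘ₗ LinearMap.funLeft ℚ ℚ (fun i => Fin.cast h9.symm (Fin.natAdd (k + 1) i))
  have hΦ : ∀ x y, Φ (Fin.append x y ∘ Fin.cast h9) = φ x + ψ y := by
    intro x y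
    have e1 : LinearMap.funLeft ℚ ℚ (fun i => Fin.cast h9.symm (Fin.castAdd (8 - k) i))
        (Fin.append x y ∘ Fin.cast h9) = x := by
      funext i; simp [LinearMap.funLeft_apply]
    have e2 : LinearMap.funLeft ℚ ℚ (fun i => Fin.cast h9.symm (Fin.natAdd (k + 1) i))
        (Fin.append x y ∘ Fin.cast h9) = y := by
      funext i; simp [LinearMap.funLeft_apply]
    simp only [Φ, LinearMap.add_apply, LinearMap.comp_apply]
    rw [e1, e2]
  refine ⟨8 - k, h9, LinearMap.BilinForm.toMatrix' (LinearMap.BilinForm.comp Bq ψ ψ),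
    LinearMap.toMatrix' Φ, ?_, ?_⟩
  · intro hdet
    obtain ⟨z, hz, hz0⟩ := Matrix.exists_mulVec_eq_zero_iff.2 hdet
    rw [LinearMap.toMatrix'_mulVec] at hz0
    obtain ⟨x, y, rfl⟩ : ∃ (x : Fin (k + 1) → ℚ) (y : Fin (8 - k) → ℚ),
        z = Fin.append x y ∘ Fin.cast h9 := by
      refine ⟨fun i => z (Fin.cast h9.symm (Fin.castAdd (8 - k) i)),
        fun i => z (Fin.cast h9.symm (Fin.natAdd (k + 1) i)), ?_⟩
      funext i
      obtain ⟨j, rfl⟩ : ∃ j, i = Fin.cast h9.symm j := ⟨Fin.cast h9 i, by simp⟩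
      refine Fin.addCases (fun a => ?_) (fun a => ?_) j <;> simp
    rw [hΦ] at hz0
    have hx : x = 0 := by
      apply Matrix.eq_zero_of_mulVec_eq_zero hGns
      apply dotProduct_eq_zero
      intro x'
      have h1 : Bq (φ x') (φ x + ψ y) = 0 := by rw [hz0, map_zero]
      rw [map_add, hcross, hφ, add_zero, Matrix.toBilin'_apply'] at h1
      rw [dotProduct_comm]; exact h1
    subst hx
    rw [map_zero, zero_add] at hz0
    have hy := hψ0 y hz0
    subst hy
    apply hz
    funext i
    obtain ⟨j, rfl⟩ : ∃ j, i = Fin.cast h9.symm j := ⟨Fin.cast h9 i, by simp⟩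
    refine Fin.addCases (fun a => ?_) (fun a => ?_) j <;> simp
  · intro x y
    rw [LinearMap.toMatrix'_mulVec, hΦ, qeval_eq, qeval_eq, qeval_eq,
      Matrix.toBilin'_toMatrix', LinearMap.BilinForm.comp_apply]
    change Bq (φ x + ψ y) (φ x + ψ y) = _
    simp only [map_add, LinearMap.add_apply]
    rw [hcross, Bq_symm (ψ y) (φ x), hcross, hφ]
    ring

end Paper
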